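/- arXiv:0708.2155 — 3 statements merged into one kernel-verified Lean document; each statement's English description precedes it below -/
import Mathlib

section
/- Let n ≥ 1, 1 ≤ r ≤ n, and s = n − r. Let ρ be a real-valued C² function defined on an open neighborhood of 0 in ℂⁿ with ρ(0) = 0, such that 0 is a nondegenerate critical point of ρ and the Levi form of ρ at 0 has at least r positive eigenvalues. Then there exist a ℂ-linear automorphism B of ℂⁿ, an ℝ-linear map h : ℂ^s → ℂ^r, an ℝ-linear automorphism g of ℂ^s ≅ ℝ^{2s}, integers k ∈ {0,…,r} and m ∈ {0,…,2s}, and real numbers λ₁,…,λ_r with λ_j > 1 for 1 ≤ j ≤ k and λ_j ≥ 1 for k < j ≤ r, with the following property. Writing Bz = (ζ, w) ∈ ℂ^r × ℂ^s, set Φ(z) = (ζ + h(w), g(w)), and write Φ(z) = (x + iy, u) with x, y ∈ ℝ^r and u ∈ ℝ^{2s}; define ρ̃(x+iy, u) = −Σ_{j=1}^k x_j² − Σ_{i=1}^m u_i² + Σ_{j=k+1}^r x_j² + Σ_{i=m+1}^{2s} u_i² + Σ_{j=1}^r λ_j y_j². Then ρ(z) = ρ̃(Φ(z)) + o(|z|²)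 as z → 0. Moreover, k + m equals the Morse index of ρ at 0. -/
open Set Metric Complex Bornology

noncomputable section

/-- The Levi form of a C² function `ρ` at `x` in direction `v`:
`L_ρ(x;v) = (1/4)(D²ρ(x)[v,v] + D²ρ(x)[iv,iv])`. -/
def leviForm {E : Type*} [NormedAddCommGroup E] [NormedSpace ℂ E]
    (ρ : E → ℝ) (x v : E) : ℝ :=
  (1 / 4) * (iteratedFDeriv ℝ 2 ρ x ![v, v] +
    iteratedFDeriv ℝ 2 ρ x ![Complex.I • v, Complex.I • v])

/-- The Levi form of `ρ` at `x` has at least `r` positive eigenvalues: there is an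
`r`-dimensional complex subspace on which it is positive on nonzero vectors. -/
def LeviPosEigenAtLeast {E : Type*} [NormedAddCommGroup E] [NormedSpace ℂ E]
    (ρ : E → ℝ) (x : E) (r : ℕ) : Prop :=
  ∃ V : Submodule ℂ E, Module.finrank ℂ V = r ∧ ∀ v ∈ V, v ≠ 0 → 0 < leviForm ρ x v

/-- A bounded strongly pseudoconvex domain in `ℂ^d` with boundary of class `C^ℓ`. -/
def IsSPCDomain {d : ℕ} (D : Set (EuclideanSpace ℂ (Fin d))) (ℓ : ℕ∞) : Prop :=
  IsOpen D ∧ IsConnected D ∧ IsBounded D ∧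
  ∃ (U : Set (EuclideanSpace ℂ (Fin d))) (rD : EuclideanSpace ℂ (Fin d) → ℝ),
    IsOpen U ∧ frontier D ⊆ U ∧ ContDiffOn ℝ ℓ rD U ∧
    D ∩ U = {x ∈ U | rD x < 0} ∧
    (∀ x ∈ frontier D, fderiv ℝ rD x ≠ 0) ∧
    (∀ x ∈ frontier D, ∀ v : EuclideanSpace ℂ (Fin d), v ≠ 0 →
      fderiv ℝ rD x v = 0 → fderiv ℝ rD x (Complex.I • v) = 0 → 0 < leviForm rD x v)

open Asymptotics Filter

/-- The identification of `ℂ^s` with `ℝ^{2s}`: the first `s` coordinates are the real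
parts, the last `s` coordinates the imaginary parts. -/
def uCoord {s : ℕ} (w : EuclideanSpace ℂ (Fin s)) : Fin (2 * s) → ℝ :=
  fun i => if h : (i : ℕ) < s then (w ⟨i, h⟩).re
    else (w ⟨(i : ℕ) - s, by have := i.isLt; omega⟩).im

/-- The quadratic normal form
`ρ̃(x+iy,u) = -Σ_{j<k} x_j² - Σ_{i<m} u_i² + Σ_{j≥k} x_j² + Σ_{i≥m} u_i² + Σ_j λ_j y_j²`
on `ℂ^r × ℂ^s = ℂ^r × ℝ^{2s}`. -/
def rhoTilde {r s : ℕ} (k m : ℕ) (lam : Fin r → ℝ)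
    (p : EuclideanSpace ℂ (Fin r) × EuclideanSpace ℂ (Fin s)) : ℝ :=
  (∑ j : Fin r, (if (j : ℕ) < k then -1 else 1) * (p.1 j).re ^ 2)
  + (∑ i : Fin (2 * s), (if (i : ℕ) < m then -1 else 1) * (uCoord p.2 i) ^ 2)
  + (∑ j : Fin r, lam j * (p.1 j).im ^ 2)

open scoped Topology

/-- A continuous family of quadratically homogeneous functions which is positive definite at
parameter `0` is positive definite for all nearby parameters. -/
theorem eventually_pos_of_homogeneous_family {X : Type*} [NormedAddCommGroup X] [NormedSpace ℝ X]
    [FiniteDimensional ℝ X] (F : ℝ → X → ℝ) (hF : Continuous (Function.uncurry F))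
    (hsmul : ∀ t (a : ℝ) x, F t (a • x) = a ^ 2 * F t x) (h0 : ∀ x, x ≠ 0 → 0 < F 0 x) :
    ∀ᶠ t in 𝓝 (0 : ℝ), ∀ x, x ≠ 0 → 0 < F t x := by
  have key : ∀ᶠ t in 𝓝 (0 : ℝ), ∀ x ∈ sphere (0 : X) 1, 0 < F t x := by
    refine (isCompact_sphere (0 : X) 1).eventually_forall_of_forall_eventually fun x hx => ?_
    exact (hF.tendsto (0, x)).eventually_const_lt (h0 x (ne_of_mem_sphere hx one_ne_zero))
  filter_upwards [key] with t ht x hx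
  have hx' : 0 < ‖x‖ := norm_pos_iff.2 hx
  have := ht (‖x‖⁻¹ • x) (by simp [norm_smul, hx'.ne'])
  rw [hsmul] at this
  exact pos_of_mul_pos_right this (by positivity)

section
variable {E : Type*} [NormedAddCommGroup E] [NormedSpace ℂ E] [FiniteDimensional ℂ E]

/-- If the real symmetric form `A` restricted to a Levi-positive complex subspace `V` has `e` in its
radical but `A e f > 0`, then moving `e` towards `f` gives a Levi-positive subspace of the same
dimension that contains a strictly larger `A`-positive real subspace. -/
theorem exists_larger_posDef_of_radical (A : E →L[ℝ] E →L[ℝ] ℝ) (hsymm : ∀ v w, A v w = A w v)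
    (V : Submodule ℂ E) (hV : ∀ v ∈ V, v ≠ 0 → 0 < A v v + A (I • v) (I • v))
    (P : Submodule ℝ E) (hPV : ∀ p ∈ P, p ∈ V) (hP : ∀ p ∈ P, p ≠ 0 → 0 < A p p)
    {e f : E} (heV : e ∈ V) (he : ∀ v ∈ V, A e v = 0) (hef : 0 < A e f) :
    ∃ (V' : Submodule ℂ E) (P' : Submodule ℝ E),
      Module.finrank ℂ V' = Module.finrank ℂ V ∧
      (∀ v ∈ V', v ≠ 0 → 0 < A v v + A (I • v) (I • v)) ∧ (∀ p ∈ P', p ∈ V') ∧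
      (∀ p ∈ P', p ≠ 0 → 0 < A p p) ∧ Module.finrank ℝ P' = Module.finrank ℝ P + 1 := by
  have : FiniteDimensional ℝ E := FiniteDimensional.complexToReal E
  have he0 : e ≠ 0 := by rintro rfl; simp at hef
  obtain ⟨φ, hφ⟩ := SeparatingDual.exists_eq_one (R := ℂ) he0
  let T : ℝ → E →ₗ[ℂ] E := fun t => LinearMap.id + (t : ℂ) • (φ.toLinearMap.smulRight f)
  have hT : ∀ t v, T t v = v + (t : ℂ) • φ v • f := fun t v => by simp [T]
  have hLevi : ∀ᶠ t in 𝓝 (0 : ℝ), ∀ x : V, x ≠ 0 →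
      0 < A (T t x) (T t x) + A (I • T t x) (I • T t x) := by
    refine eventually_pos_of_homogeneous_family (X := V)
      (fun t x => A (T t x) (T t x) + A (I • T t x) (I • T t x)) ?_ ?_ ?_
    · simp only [Function.uncurry_def, hT]
      fun_prop
    · intro t a x
      have : T t ((a • x : V) : E) = a • T t x := by
        rw [Submodule.coe_smul_of_tower]; exact (T t).map_smul_of_tower a _
      simp only [this, smul_comm I a, map_smul, smul_apply, smul_eq_mul]
      ring
    · intro x hx
      simpa [hT] using hV x x.2 (by simpa using hx)
  have hPos : ∀ᶠ τ in 𝓝 (0 : ℝ), ∀ x : P × ℝ, x ≠ 0 →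
      0 < A (x.1 + (τ ^ 2) • φ x.1 • f + (x.2 * τ) • f) (x.1 + (τ ^ 2) • φ x.1 • f + (x.2 * τ) • f)
        + 2 * x.2 * τ * A (φ x.1 • f) e + 2 * x.2 ^ 2 * A e f := by
    refine eventually_pos_of_homogeneous_family (X := P × ℝ)
      (fun τ x => A (x.1 + (τ ^ 2) • φ x.1 • f + (x.2 * τ) • f)
        (x.1 + (τ ^ 2) • φ x.1 • f + (x.2 * τ) • f)
        + 2 * x.2 * τ * A (φ x.1 • f) e + 2 * x.2 ^ 2 * A e f) ?_ ?_ ?_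
    · simp only [Function.uncurry_def]
      fun_prop
    · intro t a x
      have h1 : φ (a • (x.1 : E)) = a • φ x.1 := φ.map_smul_of_tower a _
      have h2 : (a • (x.1 : E)) + (t ^ 2) • (a • φ x.1) • f + (a * x.2 * t) • f
          = a • ((x.1 : E) + (t ^ 2) • φ x.1 • f + (x.2 * t) • f) := by
        rw [smul_add, smul_add, smul_comm a (t ^ 2), smul_smul a (x.2 * t), smul_assoc a, mul_assoc]
      simp only [Prod.smul_fst, Prod.smul_snd, Submodule.coe_smul, smul_eq_mul, h1, h2]
      simp only [smul_assoc, map_smul, smul_apply, smul_eq_mul]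
      ring
    · rintro ⟨p, c⟩ hx
      simp only [ne_eq, OfNat.ofNat_ne_zero, not_false_eq_true, zero_pow, zero_smul, add_zero,
        mul_zero, zero_mul]
      by_cases hp : p = 0
      · have hc : c ≠ 0 := by rintro rfl; exact hx (by simp [hp])
        have : 0 < c ^ 2 := by positivity
        simp only [hp, ZeroMemClass.coe_zero, map_zero]
        nlinarith [mul_pos this hef]
      · have h1 := hP p p.2 (by simpa using hp)
        have : 0 ≤ 2 * c ^ 2 * A e f := by positivity
        linarith
  have hLevi' := (show Tendsto (fun τ : ℝ => τ ^ 2) (𝓝 0) (𝓝 0) by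
    simpa using (continuous_pow 2).tendsto (0 : ℝ)).eventually hLevi
  obtain ⟨τ, ⟨h1, h2⟩, hτ⟩ := ((((hLevi'.and hPos).filter_mono nhdsWithin_le_nhds).and
    (self_mem_nhdsWithin (a := (0 : ℝ)) (s := Ioi 0)))).exists
  have hτ : 0 < τ := hτ
  let G : P × ℝ →ₗ[ℝ] E := ((T (τ ^ 2)).restrictScalars ℝ) ∘ₗ
    (P.subtype.coprod ((LinearMap.toSpanSingleton ℝ E e).comp (τ⁻¹ • LinearMap.id)))
  have hG : ∀ x, G x = T (τ ^ 2) (x.1 + (τ⁻¹ * x.2) • e) := fun x => by simp [G]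
  have hGpos : ∀ x, x ≠ 0 → 0 < A (G x) (G x) := by
    intro x hx
    convert h2 x hx using 1
    have : G x = (x.1 + (τ ^ 2) • φ x.1 • f + (x.2 * τ) • f) + (τ⁻¹ * x.2) • e := by
      have h3 : φ ((τ⁻¹ * x.2) • e) = ((τ⁻¹ * x.2 : ℝ) : ℂ) := by
        rw [φ.map_smul_of_tower, hφ]; simp
      have h4 : ((τ ^ 2 : ℝ) : ℂ) * ((τ⁻¹ * x.2 : ℝ) : ℂ) = ((x.2 * τ : ℝ) : ℂ) := by
        rw [← Complex.ofReal_mul]; congr 1; field_simp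
      rw [hG, hT, map_add, h3, add_smul, smul_add, smul_smul _ ((τ⁻¹ * x.2 : ℝ) : ℂ), h4]
      simp only [Complex.coe_smul]
      abel
    have h5 : A x.1 e = 0 := by rw [hsymm]; exact he _ (hPV _ x.1.2)
    rw [this]
    generalize hy : (x.1 + (τ ^ 2) • φ x.1 • f + (x.2 * τ) • f : E) = y
    have h6 : A y e = τ ^ 2 * A (φ x.1 • f) e + x.2 * τ * A e f := by
      rw [← hy, hsymm e f]; simp [h5]
    simp only [map_add, map_smul, add_apply, smul_apply,
      smul_eq_mul, hsymm e y, h6, he e heV]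
    field_simp
    ring
  have hGinj : Function.Injective G := by
    rw [injective_iff_map_eq_zero]
    intro x hx
    by_contra h
    simpa [hx] using hGpos x h
  have hTinj : Function.Injective ((T (τ ^ 2)).domRestrict V) := by
    rw [injective_iff_map_eq_zero]
    intro x hx
    by_contra h
    have hx' : T (τ ^ 2) x = 0 := hx
    simpa [hx'] using h1 x h
  refine ⟨LinearMap.range ((T (τ ^ 2)).domRestrict V), LinearMap.range G, ?_, ?_, ?_, ?_, ?_⟩
  · exact LinearMap.finrank_range_of_inj hTinj
  · rintro _ ⟨x, rfl⟩ hx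
    exact h1 x (by rintro rfl; simp at hx)
  · rintro _ ⟨x, rfl⟩
    refine ⟨⟨x.1 + (τ⁻¹ * x.2) • e, V.add_mem (hPV _ x.1.2) (V.smul_of_tower_mem _ heV)⟩, ?_⟩
    rw [hG]; rfl
  · rintro _ ⟨x, rfl⟩ hx
    exact hGpos x (by rintro rfl; simp at hx)
  · rw [LinearMap.finrank_range_of_inj hGinj]; simp

/-- A Levi-positive complex subspace for a nondegenerate form `A` can be replaced by one of the same
dimension on which `A` is nondegenerate. -/
theorem exists_nondegenerate_leviPos_subspace (A : E →L[ℝ] E →L[ℝ] ℝ)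
    (hsymm : ∀ v w, A v w = A w v) (hnd : ∀ v, v ≠ 0 → ∃ w, A v w ≠ 0)
    (V : Submodule ℂ E) (hV : ∀ v ∈ V, v ≠ 0 → 0 < A v v + A (I • v) (I • v)) :
    ∃ V' : Submodule ℂ E, Module.finrank ℂ V' = Module.finrank ℂ V ∧
      (∀ v ∈ V', v ≠ 0 → 0 < A v v + A (I • v) (I • v)) ∧
      ∀ v ∈ V', (∀ w ∈ V', A v w = 0) → v = 0 := by
  have : FiniteDimensional ℝ E := FiniteDimensional.complexToReal E
  let S : Set ℕ := {d | ∃ (V' : Submodule ℂ E) (P : Submodule ℝ E),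
      Module.finrank ℂ V' = Module.finrank ℂ V ∧
      (∀ v ∈ V', v ≠ 0 → 0 < A v v + A (I • v) (I • v)) ∧ (∀ p ∈ P, p ∈ V') ∧
      (∀ p ∈ P, p ≠ 0 → 0 < A p p) ∧ Module.finrank ℝ P = d}
  have hS : S.Nonempty :=
    ⟨0, V, ⊥, rfl, hV, by simp, by simp, by simp⟩
  have hB : BddAbove S := ⟨Module.finrank ℝ E, by
    rintro _ ⟨_, P, -, -, -, -, rfl⟩; exact P.finrank_le⟩
  obtain ⟨V', P, hV'r, hV', hPV, hP, hPd⟩ := Nat.sSup_mem hS hB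
  refine ⟨V', hV'r, hV', fun e heV he => ?_⟩
  by_contra he0
  obtain ⟨f, hf⟩ : ∃ f, 0 < A e f := by
    obtain ⟨w, hw⟩ := hnd e he0
    rcases lt_or_gt_of_ne hw with h | h
    · exact ⟨-w, by simpa using h⟩
    · exact ⟨w, h⟩
  obtain ⟨V'', P', h1, h2, h3, h4, h5⟩ :=
    exists_larger_posDef_of_radical A hsymm V' hV' P hPV hP heV he hf
  have := le_csSup hB (show Module.finrank ℝ P' ∈ S from ⟨V'', P', h1.trans hV'r, h2, h3, h4, rfl⟩)
  omega
end

/-- Second order Taylor expansion at a critical point. -/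
theorem ContDiffAt.isLittleO_sub_half_fderiv_fderiv {E : Type*} [NormedAddCommGroup E]
    [NormedSpace ℝ E] {ρ : E → ℝ} (hρ : ContDiffAt ℝ 2 ρ 0) (h0 : ρ 0 = 0)
    (hcrit : fderiv ℝ ρ 0 = 0) :
    (fun z => ρ z - (1 / 2) * fderiv ℝ (fderiv ℝ ρ) 0 z z) =o[𝓝 0] fun z => ‖z‖ ^ 2 := by
  set H := fderiv ℝ (fderiv ℝ ρ) 0 with hH
  have hsymm : ∀ v w, H v w = H w v := hρ.isSymmSndFDerivAt (by simp)
  have hd : DifferentiableAt ℝ (fderiv ℝ ρ) 0 :=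
    (hρ.fderiv_right (m := 1) (by norm_num)).differentiableAt (by simp)
  have hlin : (fun z => fderiv ℝ ρ z - H z) =o[𝓝 0] fun z => ‖z - 0‖ ^ 1 := by
    have := hd.hasFDerivAt.isLittleO
    simpa [hcrit, hH] using this.norm_right
  have hev : ∀ᶠ z in 𝓝 (0 : E), DifferentiableAt ℝ ρ z := by
    filter_upwards [hρ.eventually (by simp)] with z hz using hz.differentiableAt (by simp)
  obtain ⟨ε, hε, hball⟩ := Metric.eventually_nhds_iff_ball.1 hev
  have hderiv : ∀ z ∈ ball (0 : E) ε, HasFDerivWithinAt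
      (fun z => ρ z - (1 / 2) * H z z) (fderiv ℝ ρ z - H z) (ball 0 ε) z := by
    intro z hz
    have h1 := (hball z hz).hasFDerivAt
    have h2 : HasFDerivAt (fun z => H z z) (H z + H.flip z) z := by
      have := H.hasFDerivAt (x := z) |>.clm_apply (hasFDerivAt_id z)
      exact this
    have h3 := h1.sub (h2.const_mul (1 / 2))
    refine (h3.congr_fderiv ?_).hasFDerivWithinAt
    ext v
    simp [hsymm v z]; ring
  have := (convex_ball (0 : E) ε).isLittleO_pow_succ (mem_ball_self hε) hderiv
    (hlin.mono nhdsWithin_le_nhds)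
  rw [nhdsWithin_eq_nhds.2 (ball_mem_nhds _ hε)] at this
  simpa [h0] using this

/-- The quotient of a real quadratic form by its positive definite Levi form attains its minimum. -/
theorem exists_isMinOn_leviQuotient {E : Type*} [NormedAddCommGroup E] [NormedSpace ℂ E]
    [FiniteDimensional ℂ E] [Nontrivial E] (A : E →L[ℝ] E →L[ℝ] ℝ)
    (hL : ∀ v, v ≠ 0 → 0 < A v v + A (I • v) (I • v)) :
    ∃ e : E, e ≠ 0 ∧ ∃ μ : ℝ, A e e = μ * (A e e + A (I • e) (I • e)) ∧
      ∀ v, μ * (A v v + A (I • v) (I • v)) ≤ A v v := by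
  have : FiniteDimensional ℝ E := FiniteDimensional.complexToReal E
  have hne : (sphere (0 : E) 1).Nonempty := NormedSpace.sphere_nonempty.2 zero_le_one
  obtain ⟨e, he, hmin⟩ := (isCompact_sphere (0 : E) 1).exists_isMinOn hne
    (f := fun v => A v v / (A v v + A (I • v) (I • v)))
    (ContinuousOn.div (by fun_prop) (by fun_prop)
      fun v hv => (hL v (ne_of_mem_sphere hv one_ne_zero)).ne')
  have he0 : e ≠ 0 := ne_of_mem_sphere he one_ne_zero
  refine ⟨e, he0, _, (div_mul_cancel₀ _ (hL e he0).ne').symm, fun v => ?_⟩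
  rcases eq_or_ne v 0 with rfl | hv
  · simp
  have hv' : ‖v‖ ≠ 0 := norm_ne_zero_iff.2 hv
  have h1 := isMinOn_iff.1 hmin (‖v‖⁻¹ • v) (by simp [norm_smul, hv'])
  rw [← le_div_iff₀ (hL v hv)]
  refine h1.trans_eq ?_
  simp only [smul_comm I ‖v‖⁻¹, map_smul, smul_apply, smul_eq_mul]
  field_simp

theorem eq_zero_of_nonneg_of_apply_self_eq_zero {E : Type*} [AddCommGroup E] [Module ℝ E]
    (S : E →ₗ[ℝ] E →ₗ[ℝ] ℝ) (hsymm : ∀ v w, S v w = S w v) (hS : ∀ v, 0 ≤ S v v) {e : E}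
    (he : S e e = 0) (w : E) : S e w = 0 := by
  by_contra h
  obtain ⟨c, hc⟩ : ∃ c, c * S e w = -(S w w + 1) := ⟨_, div_mul_cancel₀ _ h⟩
  have h1 := hS (c • e + w)
  have h2 := hS w
  simp only [map_add, map_smul, LinearMap.add_apply, LinearMap.smul_apply, smul_eq_mul, he,
    hsymm w e] at h1
  linarith

/-- Takagi factorization: a real symmetric form with positive definite Levi form is diagonal in the
real coordinates of a suitable complex basis. -/
theorem exists_basis_diagonalizing (r : ℕ) : ∀ {E : Type*} [NormedAddCommGroup E] [NormedSpace ℂ E]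
    [FiniteDimensional ℂ E] (A : E →L[ℝ] E →L[ℝ] ℝ) (_ : ∀ v w, A v w = A w v)
    (_ : ∀ v, v ≠ 0 → 0 < A v v + A (I • v) (I • v)) (_ : Module.finrank ℂ E = r),
    ∃ b : Module.Basis (Fin r) ℂ E,
      (∀ i j, i ≠ j → A (b i) (b j) = 0 ∧ A (I • b i) (I • b j) = 0) ∧
      (∀ i j, A (b i) (I • b j) = 0) ∧
      ∀ i, A (b i) (b i) ≤ A (I • b i) (I • b i) := by
  induction r with
  | zero =>
    intro E _ _ _ A hsymm hL hr
    exact ⟨Module.finBasisOfFinrankEq ℂ E hr, fun i => i.elim0, fun i => i.elim0,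
      fun i => i.elim0⟩
  | succ r ih =>
    intro E _ _ _ A hsymm hL hr
    have : Nontrivial E := Module.nontrivial_of_finrank_pos (R := ℂ) (by omega)
    obtain ⟨e, he0, μ, hμ, hmin⟩ := exists_isMinOn_leviQuotient A hL
    have hII : ∀ v : E, I • I • v = -v := fun v => by rw [smul_smul, I_mul_I, neg_one_smul]
    let Lf : E →ₗ[ℝ] E →ₗ[ℝ] ℝ := LinearMap.mk₂ ℝ (fun v w => A v w + A (I • v) (I • w))
      (fun a b c => by simp; ring)
      (fun t a b => by simp [smul_comm I t]; ring)
      (fun a b c => by simp; ring)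
      (fun t a b => by simp [smul_comm I t]; ring)
    have hLf : ∀ v w, Lf v w = A v w + A (I • v) (I • w) := fun v w => rfl
    let Sf : E →ₗ[ℝ] E →ₗ[ℝ] ℝ := LinearMap.mk₂ ℝ (fun v w => A v w - μ * Lf v w)
      (fun a b c => by simp; ring)
      (fun t a b => by simp; ring)
      (fun a b c => by simp; ring)
      (fun t a b => by simp; ring)
    have hSf : ∀ v w, Sf v w = A v w - μ * Lf v w := fun v w => rfl
    have hrad : ∀ w, A e w = μ * Lf e w := by
      intro w
      have := eq_zero_of_nonneg_of_apply_self_eq_zero Sf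
        (fun v w => by rw [hSf, hSf, hLf, hLf, hsymm v, hsymm (I • v)])
        (fun v => by rw [hSf, hLf]; linarith [hmin v]) (e := e)
        (by rw [hSf, hLf]; linarith) w
      rw [hSf] at this
      linarith
    -- the complex functional whose kernel is the Levi-orthogonal complement of `e`
    let ψ : E →ₗ[ℂ] ℂ :=
      { toFun := fun w => (Lf e w : ℂ) - I * (Lf e (I • w) : ℂ)
        map_add' := fun a b => by simp only [smul_add, map_add, ofReal_add]; ring
        map_smul' := fun c w => by
          have hc : c • w = c.re • w + c.im • (I • w) := by
            conv_lhs => rw [← re_add_im c]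
            rw [add_smul, mul_smul, coe_smul, coe_smul]
          have hc' : I • c • w = c.re • (I • w) + c.im • (-w) := by
            rw [hc, smul_add, smul_comm I, smul_comm I c.im, hII]
          rw [hc', hc]
          simp only [map_add, map_smul, map_neg, smul_eq_mul, RingHom.id_apply]
          apply Complex.ext
          · simp
          · simp; ring }
    have hψ : ∀ w, ψ w = 0 ↔ Lf e w = 0 ∧ Lf e (I • w) = 0 := by
      intro w
      change (Lf e w : ℂ) - I * (Lf e (I • w) : ℂ) = 0 ↔ _
      simp [Complex.ext_iff]
    have hLe : Lf e (I • e) = 0 := by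
      rw [hLf, hII, map_neg, hsymm (I • e)]; ring
    have hψe : ψ e ≠ 0 := by
      rw [Ne, hψ, hLf]
      exact fun h => (hL e he0).ne' h.1
    have hF : Module.finrank ℂ (LinearMap.ker ψ) = r := by
      have h1 := LinearMap.finrank_range_add_finrank_ker ψ
      have h2 : LinearMap.range ψ = ⊤ := LinearMap.range_eq_top.2
        (LinearMap.surjective (by rintro h; simp [h] at hψe))
      rw [h2, finrank_top, hr] at h1
      simp at h1
      omega
    have horth : ∀ w ∈ LinearMap.ker ψ, A e w = 0 ∧ A (I • e) (I • w) = 0 ∧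
        A e (I • w) = 0 ∧ A w (I • e) = 0 := by
      intro w hw
      obtain ⟨h1, h2⟩ := (hψ w).1 hw
      have h3 : A e w = 0 := by rw [hrad, h1, mul_zero]
      have h4 : A e (I • w) = 0 := by rw [hrad, h2, mul_zero]
      rw [hLf] at h1 h2
      rw [hII, map_neg] at h2
      exact ⟨h3, by linarith, h4, by rw [hsymm]; linarith⟩
    obtain ⟨b, hb1, hb2, hb3⟩ := ih (E := LinearMap.ker ψ)
      ((((ContinuousLinearMap.compL ℝ (LinearMap.ker ψ) E ℝ).flip
        ((LinearMap.ker ψ).subtypeL.restrictScalars ℝ)).comp A).comp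
        ((LinearMap.ker ψ).subtypeL.restrictScalars ℝ))
      (fun v w => hsymm v w) (fun v hv => hL v (by simpa using hv)) hF
    replace hb1 : ∀ i j, i ≠ j → A (b i) (b j) = 0 ∧ A (I • (b i : E)) (I • (b j : E)) = 0 := hb1
    replace hb2 : ∀ i j, A (b i) (I • (b j : E)) = 0 := hb2
    replace hb3 : ∀ i, A (b i) (b i) ≤ A (I • (b i : E)) (I • (b i : E)) := hb3
    refine ⟨Module.Basis.mkFinCons e b ?_ ?_, ?_, ?_, ?_⟩
    · intro c x hx h
      have := congrArg ψ h
      rw [map_add, LinearMap.mem_ker.1 hx, map_smul, map_zero, add_zero, smul_eq_mul] at this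
      exact (mul_eq_zero.1 this).resolve_right hψe
    · intro z
      refine ⟨-(ψ z / ψ e), ?_⟩
      rw [LinearMap.mem_ker, map_add, map_smul, smul_eq_mul]
      field_simp
      ring
    · intro i j
      rw [Module.Basis.coe_mkFinCons]
      refine Fin.cases ?_ (fun i => ?_) i <;> refine Fin.cases ?_ (fun j => ?_) j <;> intro hij
      · exact absurd rfl hij
      · exact ⟨(horth _ (b j).2).1, (horth _ (b j).2).2.1⟩
      · exact ⟨(hsymm _ _).trans (horth _ (b i).2).1, (hsymm _ _).trans (horth _ (b i).2).2.1⟩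
      · exact hb1 i j (fun h => hij (by rw [h]))
    · intro i j
      rw [Module.Basis.coe_mkFinCons]
      refine Fin.cases ?_ (fun i => ?_) i <;> refine Fin.cases ?_ (fun j => ?_) j
      · simp [hrad, hLe]
      · exact (horth _ (b j).2).2.2.1
      · exact (horth _ (b i).2).2.2.2
      · exact hb2 i j
    · intro i
      rw [Module.Basis.coe_mkFinCons]
      refine Fin.cases ?_ (fun i => ?_) i
      · have h1 := hmin (I • e)
        rw [hII, map_neg, map_neg, neg_apply, neg_neg, add_comm, ← hμ] at h1
        exact h1
      · exact hb3 i

/-- The value of a form in coordinates with respect to a diagonalizing complex basis. -/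
theorem apply_eq_sum_of_diagonal_basis {r : ℕ} {E : Type*} [NormedAddCommGroup E] [NormedSpace ℂ E]
    (A : E →L[ℝ] E →L[ℝ] ℝ) (hsymm : ∀ v w, A v w = A w v) (b : Module.Basis (Fin r) ℂ E)
    (hb : ∀ i j, i ≠ j → A (b i) (b j) = 0 ∧ A (I • b i) (I • b j) = 0)
    (hbI : ∀ i j, A (b i) (I • b j) = 0) (v w : E) :
    A v w = ∑ i, (A (b i) (b i) * (b.repr v i).re * (b.repr w i).re
      + A (I • b i) (I • b i) * (b.repr v i).im * (b.repr w i).im) := by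
  have hrep : ∀ u : E, u = ∑ i, ((b.repr u i).re • b i + (b.repr u i).im • I • b i) := by
    intro u
    conv_lhs => rw [← b.sum_repr u]
    refine Finset.sum_congr rfl fun i _ => ?_
    conv_lhs => rw [← re_add_im (b.repr u i)]
    rw [add_smul, mul_smul, coe_smul, coe_smul]
  have h1 : ∀ i, A (b i) w = A (b i) (b i) * (b.repr w i).re := by
    intro i
    conv_lhs => rw [hrep w]
    rw [map_sum, Finset.sum_eq_single i]
    · simp [hbI]; ring
    · intro j _ hj
      simp [hbI, (hb i j hj.symm).1]
    · simp
  have h2 : ∀ i, A (I • b i) w = A (I • b i) (I • b i) * (b.repr w i).im := by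
    intro i
    conv_lhs => rw [hrep w]
    rw [map_sum, Finset.sum_eq_single i]
    · simp [hsymm (I • b i) (b _), hbI]; ring
    · intro j _ hj
      simp [hsymm (I • b i) (b _), hbI, (hb i j hj.symm).2]
    · simp
  conv_lhs => rw [hrep v]
  rw [map_sum, sum_apply]
  refine Finset.sum_congr rfl fun i _ => ?_
  simp only [map_add, map_smul, add_apply, smul_apply, smul_eq_mul, h1, h2]
  ring

/-- A predicate on `Fin d` becomes an initial segment after a permutation. -/
theorem exists_perm_iff_lt {d : ℕ} (p : Fin d → Prop) :
    ∃ (σ : Equiv.Perm (Fin d)) (k : ℕ), k ≤ d ∧ ∀ i, p (σ i) ↔ (i : ℕ) < k := by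
  classical
  let k := Fintype.card {i // p i}
  have hk : k ≤ d := (Fintype.card_subtype_le p).trans_eq (Fintype.card_fin d)
  have hcard : Fintype.card {i : Fin d // (i : ℕ) < k} = Fintype.card {i // p i} := by
    rw [Fintype.card_subtype, Fin.card_filter_val_lt, min_eq_right hk]
  let e := Fintype.equivOfCardEq hcard
  refine ⟨e.extendSubtype, k, hk, fun i => ⟨fun h => ?_, fun h => e.extendSubtype_mem i h⟩⟩
  by_contra hi
  exact e.extendSubtype_not_mem i hi h

/-- Normal form of a nondegenerate real quadratic form with positive definite Levi form. -/
theorem exists_equiv_sum_sq_of_leviPos {r : ℕ} {E : Type*} [NormedAddCommGroup E] [NormedSpace ℂ E]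
    [FiniteDimensional ℂ E] (A : E →L[ℝ] E →L[ℝ] ℝ) (hsymm : ∀ v w, A v w = A w v)
    (hL : ∀ v, v ≠ 0 → 0 < A v v + A (I • v) (I • v)) (hnd : ∀ v, (∀ w, A v w = 0) → v = 0)
    (hr : Module.finrank ℂ E = r) :
    ∃ (β : E ≃ₗ[ℂ] EuclideanSpace ℂ (Fin r)) (k : ℕ) (lam : Fin r → ℝ), k ≤ r ∧
      (∀ j : Fin r, (j : ℕ) < k → 1 < lam j) ∧ (∀ j : Fin r, k ≤ (j : ℕ) → 1 ≤ lam j) ∧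
      ∀ v, A v v = (∑ j : Fin r, (if (j : ℕ) < k then -1 else 1) * (β v j).re ^ 2)
        + ∑ j : Fin r, lam j * (β v j).im ^ 2 := by
  obtain ⟨b, hb, hbI, hle⟩ := exists_basis_diagonalizing r A hsymm hL hr
  have ha : ∀ i, A (b i) (b i) ≠ 0 := by
    intro i h
    refine b.ne_zero i (hnd _ fun w => ?_)
    rw [apply_eq_sum_of_diagonal_basis A hsymm b hb hbI]
    refine Finset.sum_eq_zero fun j _ => ?_
    rcases eq_or_ne i j with rfl | hij
    · simp [h]
    · simp [hij]
  obtain ⟨σ, k, hk, hσ⟩ := exists_perm_iff_lt fun i => A (b i) (b i) < 0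
  let t : Fin r → ℝ := fun i => (√|A (b i) (b i)|)⁻¹
  have ht : ∀ i, 0 < t i := fun i => by have := abs_pos.2 (ha i); positivity
  have ht2 : ∀ i, t i ^ 2 * |A (b i) (b i)| = 1 := fun i => by
    have := abs_pos.2 (ha i)
    rw [inv_pow, Real.sq_sqrt this.le, inv_mul_cancel₀ this.ne']
  let b' : Module.Basis (Fin r) ℂ E := (b.isUnitSMul (w := fun i => (t i : ℂ))
    fun i => isUnit_iff_ne_zero.2 (by exact_mod_cast (ht i).ne')).reindex σ.symm
  have hb' : ∀ i, b' i = t (σ i) • b (σ i) := fun i => by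
    simp [b', Module.Basis.isUnitSMul_apply]
  have hself : ∀ i, A (b' i) (b' i) = t (σ i) ^ 2 * A (b (σ i)) (b (σ i)) := fun i => by
    simp [hb']; ring
  have hself' : ∀ i, A (I • b' i) (I • b' i)
      = t (σ i) ^ 2 * A (I • b (σ i)) (I • b (σ i)) := fun i => by
    simp [hb', smul_comm I (t _)]; ring
  have hsum := fun v => apply_eq_sum_of_diagonal_basis A hsymm b'
    (fun i j hij => by
      have := hb (σ i) (σ j) (σ.injective.ne hij)
      simp [hb', smul_comm I (t _), this])
    (fun i j => by simp [hb', smul_comm I (t _), hbI]) v v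
  have hLb := fun i => hL (b i) (b.ne_zero i)
  refine ⟨b'.equivFun ≪≫ₗ (WithLp.linearEquiv 2 ℂ (Fin r → ℂ)).symm, k,
    fun i => A (I • b' i) (I • b' i), hk, fun j hj => ?_, fun j hj => ?_, fun v => ?_⟩
  · have h1 := (hσ j).2 hj
    have h2 := ht2 (σ j)
    rw [abs_of_neg h1] at h2
    simp only [hself']
    nlinarith [hLb (σ j), pow_pos (ht (σ j)) 2]
  · have h1 := not_lt.1 (mt (hσ j).1 hj.not_gt)
    have h2 := ht2 (σ j)
    rw [abs_of_nonneg h1] at h2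
    simp only [hself']
    nlinarith [hle (σ j), pow_pos (ht (σ j)) 2]
  · rw [hsum, Finset.sum_add_distrib]
    congr 1
    · refine Finset.sum_congr rfl fun j _ => ?_
      have h2 := ht2 (σ j)
      have h3 : A (b' j) (b' j) = if (j : ℕ) < k then -1 else 1 := by
        rw [hself]
        split_ifs with h
        · rw [abs_of_neg ((hσ j).2 h)] at h2; linarith
        · rw [abs_of_nonneg (not_lt.1 (mt (hσ j).1 h))] at h2; linarith
      rw [h3, mul_assoc, ← sq]
      simp
    · refine Finset.sum_congr rfl fun j _ => ?_
      rw [mul_assoc, ← sq]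
      simp

/-- Sylvester's normal form with the negative squares first. -/
theorem exists_equiv_signed_sum_sq {d : ℕ} {F : Type*} [AddCommGroup F] [Module ℝ F]
    [FiniteDimensional ℝ F] (S : F →ₗ[ℝ] F →ₗ[ℝ] ℝ) (hsymm : ∀ v w, S v w = S w v)
    (hnd : ∀ v, (∀ w, S v w = 0) → v = 0) (hd : Module.finrank ℝ F = d) :
    ∃ (γ : F ≃ₗ[ℝ] (Fin d → ℝ)) (m : ℕ), m ≤ d ∧
      ∀ w, S w w = ∑ i : Fin d, (if (i : ℕ) < m then -1 else 1) * (γ w i) ^ 2 := by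
  subst hd
  let Q : QuadraticForm ℝ F := LinearMap.BilinMap.toQuadraticMap S
  have hQ : QuadraticMap.associated (R := ℝ) Q = S :=
    QuadraticMap.associated_left_inverse ℝ (B₁ := S) hsymm
  obtain ⟨w, hw, ⟨f⟩⟩ := QuadraticForm.equivalent_one_neg_one_weighted_sum_squared Q
    (by rw [hQ]; exact hnd)
  obtain ⟨σ, m, hm, hσ⟩ := exists_perm_iff_lt fun i => w i = -1
  refine ⟨f.toLinearEquiv ≪≫ₗ LinearEquiv.funCongrLeft ℝ ℝ σ, m, hm, fun x => ?_⟩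
  have h1 : S x x = QuadraticMap.weightedSumSquares ℝ w (f x) := (f.map_app x).symm
  rw [h1, QuadraticMap.weightedSumSquares_apply, ← Equiv.sum_comp σ]
  refine Finset.sum_congr rfl fun i _ => ?_
  have h2 : w (σ i) = if (i : ℕ) < m then -1 else 1 := by
    split_ifs with h
    · exact (hσ i).2 h
    · exact (hw _).resolve_left (mt (hσ i).1 h)
  rw [h2, smul_eq_mul, sq]
  rfl

theorem exists_linearEquiv_uCoord (s : ℕ) :
    ∃ U : EuclideanSpace ℂ (Fin s) ≃ₗ[ℝ] (Fin (2 * s) → ℝ), ∀ w, U w = uCoord w := by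
  let f : EuclideanSpace ℂ (Fin s) →ₗ[ℝ] (Fin (2 * s) → ℝ) :=
    { toFun := uCoord
      map_add' := fun v w => by
        ext i; simp only [uCoord, Pi.add_apply]; split_ifs <;> simp
      map_smul' := fun c w => by
        ext i; simp only [uCoord, Pi.smul_apply, RingHom.id_apply]; split_ifs <;> simp }
  have hf : Function.Injective f := by
    rw [injective_iff_map_eq_zero]
    intro w hw
    have h : ∀ i, uCoord w i = 0 := fun i => congrFun hw i
    ext j
    apply Complex.ext
    · simpa [uCoord] using h ⟨j, by omega⟩
    · simpa [uCoord] using h ⟨s + j, by omega⟩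
  refine ⟨LinearMap.linearEquivOfInjective f hf ?_, fun w => rfl⟩
  rw [← Module.finrank_mul_finrank ℝ ℂ]
  simp

/-- The `A`-orthogonal projection onto a subspace on which `A` is nondegenerate. -/
theorem exists_orthogonal_projection {E : Type*} [NormedAddCommGroup E] [NormedSpace ℂ E]
    [FiniteDimensional ℂ E] (A : E →L[ℝ] E →L[ℝ] ℝ) (V : Submodule ℂ E)
    (hVnd : ∀ v ∈ V, (∀ w ∈ V, A v w = 0) → v = 0) :
    ∃ π : E →ₗ[ℝ] V, (∀ z, ∀ v ∈ V, A (z - π z) v = 0) ∧ ∀ v : V, π v = v := by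
  have : FiniteDimensional ℝ V := FiniteDimensional.complexToReal V
  let R : E →ₗ[ℝ] V →ₗ[ℝ] ℝ := LinearMap.mk₂ ℝ (fun z (v : V) => A z v)
    (by simp) (by simp) (by simp) (by simp)
  let ι : V →ₗ[ℝ] E := V.subtype.restrictScalars ℝ
  have hinj : Function.Injective (R ∘ₗ ι) := by
    rw [injective_iff_map_eq_zero]
    intro v hv
    exact Subtype.ext (hVnd v v.2 fun w hw => LinearMap.congr_fun hv ⟨w, hw⟩)
  let e := LinearMap.linearEquivOfInjective (R ∘ₗ ι) hinj Subspace.dual_finrank_eq.symm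
  have he : ∀ v w : V, e v w = A v w := fun v w => rfl
  refine ⟨e.symm.toLinearMap ∘ₗ R, fun z v hv => ?_, fun v => e.symm_apply_apply v⟩
  have h1 := he (e.symm (R z)) ⟨v, hv⟩
  rw [e.apply_symm_apply] at h1
  rw [map_sub, sub_apply, sub_eq_zero]
  exact h1

/-- Algebraic normal form of a nondegenerate real quadratic form that is Levi-positive on an
`r`-dimensional complex subspace. -/
theorem exists_equiv_rhoTilde {r s : ℕ} {E : Type*} [NormedAddCommGroup E] [NormedSpace ℂ E]
    [FiniteDimensional ℂ E] (hE : Module.finrank ℂ E = r + s) (A : E →L[ℝ] E →L[ℝ] ℝ)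
    (hsymm : ∀ v w, A v w = A w v) (hnd : ∀ v, v ≠ 0 → ∃ w, A v w ≠ 0)
    (hL : ∃ V : Submodule ℂ E, Module.finrank ℂ V = r ∧
      ∀ v ∈ V, v ≠ 0 → 0 < A v v + A (I • v) (I • v)) :
    ∃ (B : E ≃ₗ[ℂ] EuclideanSpace ℂ (Fin r) × EuclideanSpace ℂ (Fin s))
      (h : EuclideanSpace ℂ (Fin s) →ₗ[ℝ] EuclideanSpace ℂ (Fin r))
      (g : EuclideanSpace ℂ (Fin s) ≃ₗ[ℝ] EuclideanSpace ℂ (Fin s))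
      (k m : ℕ) (lam : Fin r → ℝ),
      k ≤ r ∧ m ≤ 2 * s ∧
      (∀ j : Fin r, (j : ℕ) < k → 1 < lam j) ∧
      (∀ j : Fin r, k ≤ (j : ℕ) → 1 ≤ lam j) ∧
      ∀ z, A z z = rhoTilde k m lam ((B z).1 + h (B z).2, g (B z).2) := by
  obtain ⟨V₀, hV₀r, hV₀⟩ := hL
  obtain ⟨V, hVr, hVL, hVnd⟩ := exists_nondegenerate_leviPos_subspace A hsymm hnd V₀ hV₀
  rw [hV₀r] at hVr
  obtain ⟨W, hVW⟩ := V.exists_isCompl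
  have hWs : Module.finrank ℂ W = s := by
    have := Submodule.finrank_add_eq_of_isCompl hVW
    omega
  obtain ⟨π, hπ, hπV⟩ := exists_orthogonal_projection A V hVnd
  have hπ' : ∀ z, ∀ v ∈ V, A v (z - π z) = 0 := fun z v hv => by rw [hsymm]; exact hπ z v hv
  let AV : V →L[ℝ] V →L[ℝ] ℝ := (((ContinuousLinearMap.compL ℝ V E ℝ).flip
    (V.subtypeL.restrictScalars ℝ)).comp A).comp (V.subtypeL.restrictScalars ℝ)
  have hAV : ∀ v w : V, AV v w = A v w := fun v w => rfl
  obtain ⟨β, k, lam, hk, hlt, hle, hβ⟩ := exists_equiv_sum_sq_of_leviPos AV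
    (fun v w => hsymm v w) (fun v hv => hVL v v.2 (by simpa using hv))
    (fun v hv => Subtype.ext (hVnd v v.2 fun w hw => hv ⟨w, hw⟩)) hVr
  let ω : W ≃ₗ[ℂ] EuclideanSpace ℂ (Fin s) := LinearEquiv.ofFinrankEq _ _ (by simp [hWs])
  -- the form induced on the orthogonal complement of `V`, in the coordinates of `W`
  let κ : EuclideanSpace ℂ (Fin s) →ₗ[ℝ] E :=
    (W.subtype ∘ₗ ω.symm.toLinearMap).restrictScalars ℝ
  let q : EuclideanSpace ℂ (Fin s) →ₗ[ℝ] E := κ - (V.subtype.restrictScalars ℝ) ∘ₗ π ∘ₗ κ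
  have hq : ∀ w, q w = κ w - π (κ w) := fun w => rfl
  let S : EuclideanSpace ℂ (Fin s) →ₗ[ℝ] EuclideanSpace ℂ (Fin s) →ₗ[ℝ] ℝ :=
    LinearMap.mk₂ ℝ (fun v w => A (q v) (q w)) (by simp) (by simp) (by simp) (by simp)
  have hS : ∀ v w, S v w = A (q v) (q w) := fun v w => rfl
  let D := (V.prodEquivOfIsCompl W hVW).symm
  have hD : ∀ z, ((D z).1 : E) + (D z).2 = z := fun z =>
    (V.prodEquivOfIsCompl W hVW).apply_symm_apply z
  obtain ⟨γ, m, hm, hγ⟩ := exists_equiv_signed_sum_sq (d := 2 * s) S (fun v w => hsymm _ _)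
    (fun v hv => by
      have hqv : q v = 0 := by
        by_contra hne
        obtain ⟨z, hz⟩ := hnd _ hne
        refine hz ?_
        have h1 : z = ((D z).1 + π (D z).2 : V) + q (ω (D z).2) := by
          conv_lhs => rw [← hD z]
          simp [hq, κ]
        rw [h1, map_add, hq v, hπ _ _ (Submodule.coe_mem _), zero_add, ← hq v]
        exact hv _
      have h2 : (ω.symm v : E) ∈ V := by
        have : κ v = π (κ v) := sub_eq_zero.1 hqv
        rw [show (ω.symm v : E) = κ v from rfl, this]
        exact Submodule.coe_mem _
      have h3 := Submodule.disjoint_def.1 hVW.disjoint _ h2 (ω.symm v).2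
      simpa using h3)
    (by rw [← Module.finrank_mul_finrank ℝ ℂ]; simp)
  obtain ⟨U, hU⟩ := exists_linearEquiv_uCoord s
  refine ⟨D ≪≫ₗ (β.prodCongr ω), β.toLinearMap.restrictScalars ℝ ∘ₗ π ∘ₗ κ, γ ≪≫ₗ U.symm,
    k, m, lam, hk, hm, hlt, hle, fun z => ?_⟩
  have hz1 : ∀ w : W, κ (ω w) = w := fun w => by simp [κ]
  have hfst : ((D ≪≫ₗ (β.prodCongr ω)) z).1 + (β.toLinearMap.restrictScalars ℝ ∘ₗ π ∘ₗ κ)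
      ((D ≪≫ₗ (β.prodCongr ω)) z).2 = β (π z) := by
    have : π z = (D z).1 + π (D z).2 := by
      conv_lhs => rw [← hD z, map_add, hπV]
    rw [this, map_add]
    simp [hz1]
  have hsnd : uCoord ((γ ≪≫ₗ U.symm) ((D ≪≫ₗ (β.prodCongr ω)) z).2) = γ (ω (D z).2) := by
    rw [← hU]; simp
  have hperp : q (ω (D z).2) = z - π z := by
    rw [hq, hz1]
    conv_rhs => rw [← hD z, map_add, hπV]
    push_cast
    abel
  rw [rhoTilde, hfst, hsnd, ← hγ, hS, hperp, add_right_comm, ← hβ, hAV]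
  have h1 := hπ z (π z) (π z).2
  have h2 := hπ' z (π z) (π z).2
  conv_lhs => rw [← add_sub_cancel (π z : E) z]
  simp only [map_add, add_apply, h1, h2]
  ring

/-- The index of inertia of the normal form is `k + m`. -/
theorem isGreatest_finrank_negDef_rhoTilde {r s k m : ℕ} {lam : Fin r → ℝ} (hk : k ≤ r)
    (hm : m ≤ 2 * s) (hlam : ∀ j, 0 ≤ lam j) {E : Type*} [AddCommGroup E] [Module ℝ E]
    (Φ : E ≃ₗ[ℝ] EuclideanSpace ℂ (Fin r) × EuclideanSpace ℂ (Fin s)) :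
    IsGreatest {d | ∃ V : Submodule ℝ E, Module.finrank ℝ V = d ∧
      ∀ v ∈ V, v ≠ 0 → rhoTilde k m lam (Φ v) < 0} (k + m) := by
  have : FiniteDimensional ℝ E := Φ.symm.finiteDimensional
  obtain ⟨U, hU⟩ := exists_linearEquiv_uCoord s
  let C : EuclideanSpace ℂ (Fin r) × EuclideanSpace ℂ (Fin s) →ₗ[ℝ]
      (Fin r ⊕ Fin (2 * s) ⊕ Fin r → ℝ) :=
    { toFun := fun p => Sum.elim (fun j => (p.1 j).re) (Sum.elim (U p.2) fun j => (p.1 j).im)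
      map_add' := fun p q => by ext (i | i | i) <;> simp
      map_smul' := fun c p => by ext (i | i | i) <;> simp }
  have hC : Function.Injective C := by
    rw [injective_iff_map_eq_zero]
    intro p hp
    refine Prod.ext ?_ (U.map_eq_zero_iff.1 (funext fun i => congrFun hp (Sum.inr (Sum.inl i))))
    ext j
    exact Complex.ext (congrFun hp (Sum.inl j)) (congrFun hp (Sum.inr (Sum.inr j)))
  let C' := LinearMap.linearEquivOfInjective C hC (by
    rw [← Module.finrank_mul_finrank ℝ ℂ]; simp; ring)
  let w : Fin r ⊕ Fin (2 * s) ⊕ Fin r → ℝ := Sum.elim (fun j => if (j : ℕ) < k then -1 else 1)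
    (Sum.elim (fun i => if (i : ℕ) < m then -1 else 1) lam)
  have hw : ∀ p, QuadraticMap.weightedSumSquares ℝ w (C p) = rhoTilde k m lam p := fun p => by
    simp [QuadraticMap.weightedSumSquares_apply, w, C, rhoTilde, hU, sq, add_assoc]
  have hcard : {i | w i < 0}.ncard = k + m := by
    classical
    have h1 : ∀ a b : ℕ, b ≤ a → ∑ i : Fin a, (if (i : ℕ) < b then 1 else 0) = b := by
      intro a b hab
      rw [← Finset.card_filter, Fin.card_filter_val_lt, min_eq_right hab]
    have h2 : ∀ (p : Prop) [Decidable p], (if p then -1 else 1 : ℝ) < 0 ↔ p := by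
      intro p _
      split_ifs with h <;> simp [h]
    rw [Set.ncard_eq_toFinset_card', Set.toFinset_ofPred, Finset.card_filter]
    simp only [Fintype.sum_sum_type, w, Sum.elim_inl, Sum.elim_inr, h2, h1 _ _ hk, h1 _ _ hm,
      (hlam _).not_gt, if_false, Finset.sum_const_zero, add_zero]
  let Q := (QuadraticMap.weightedSumSquares ℝ w).comp (Φ ≪≫ₗ C').toLinearMap
  have hQ : ∀ v, Q v = rhoTilde k m lam (Φ v) := fun v => hw (Φ v)
  have hsig : sigNeg Q = k + m := by
    rw [QuadraticForm.sigNeg_of_equiv_weightedSumSquares (w := w) (Q := Q) ⟨⟨Φ ≪≫ₗ C', fun v => rfl⟩⟩, hcard]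
  have hneg : ∀ V : Submodule ℝ E, ((-Q).restrict V).PosDef ↔
      ∀ v ∈ V, v ≠ 0 → rhoTilde k m lam (Φ v) < 0 := by
    intro V
    simp [QuadraticMap.PosDef, hQ]
  have := sigNeg_isGreatest Q
  simp only [hneg, hsig] at this
  exact this

/-- Lemma 2.1: quadratic normal form of a `q`-convex function at a nondegenerate
critical point (here `r = n - q + 1`, `s = q - 1 = n - r`). -/
theorem quadratic_normal_form
    {n r s : ℕ} (hn : 1 ≤ n) (hr : 1 ≤ r) (hrs : r + s = n)
    {W : Set (EuclideanSpace ℂ (Fin n))} (hW : IsOpen W)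
    (h0W : (0 : EuclideanSpace ℂ (Fin n)) ∈ W)
    {ρ : EuclideanSpace ℂ (Fin n) → ℝ} (hρ : ContDiffOn ℝ 2 ρ W) (hρ0 : ρ 0 = 0)
    (hcrit : fderiv ℝ ρ 0 = 0)
    (hnondeg : ∀ v : EuclideanSpace ℂ (Fin n), v ≠ 0 →
      ∃ w, iteratedFDeriv ℝ 2 ρ 0 ![v, w] ≠ 0)
    (hlevi : LeviPosEigenAtLeast ρ 0 r) :
    ∃ (B : EuclideanSpace ℂ (Fin n) ≃ₗ[ℂ]
          EuclideanSpace ℂ (Fin r) × EuclideanSpace ℂ (Fin s))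
      (h : EuclideanSpace ℂ (Fin s) →ₗ[ℝ] EuclideanSpace ℂ (Fin r))
      (g : EuclideanSpace ℂ (Fin s) ≃ₗ[ℝ] EuclideanSpace ℂ (Fin s))
      (k m : ℕ) (lam : Fin r → ℝ),
      k ≤ r ∧ m ≤ 2 * s ∧
      (∀ j : Fin r, (j : ℕ) < k → 1 < lam j) ∧
      (∀ j : Fin r, k ≤ (j : ℕ) → 1 ≤ lam j) ∧
      -- `ρ(z) = ρ̃(Φ(z)) + o(|z|²)` with `Φ(z) = (ζ + h(w), g(w))`, `(ζ,w) = Bz`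
      (fun z => ρ z - rhoTilde k m lam ((B z).1 + h (B z).2, g (B z).2))
        =o[nhds (0 : EuclideanSpace ℂ (Fin n))] (fun z => ‖z‖ ^ 2) ∧
      -- `k + m` is the Morse index of `ρ` at `0`
      (∃ V : Submodule ℝ (EuclideanSpace ℂ (Fin n)), Module.finrank ℝ V = k + m ∧
        ∀ v ∈ V, v ≠ 0 → iteratedFDeriv ℝ 2 ρ 0 ![v, v] < 0) ∧
      (∀ V : Submodule ℝ (EuclideanSpace ℂ (Fin n)),
        (∀ v ∈ V, v ≠ 0 → iteratedFDeriv ℝ 2 ρ 0 ![v, v] < 0) →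
          Module.finrank ℝ V ≤ k + m) := by
  have hρ2 : ContDiffAt ℝ 2 ρ 0 := hρ.contDiffAt (hW.mem_nhds h0W)
  have hiter : ∀ v w, iteratedFDeriv ℝ 2 ρ 0 ![v, w] = fderiv ℝ (fderiv ℝ ρ) 0 v w := by
    intro v w
    rw [iteratedFDeriv_two_apply]
    rfl
  have hsymm : ∀ v w, fderiv ℝ (fderiv ℝ ρ) 0 v w = fderiv ℝ (fderiv ℝ ρ) 0 w v :=
    hρ2.isSymmSndFDerivAt (by simp)
  obtain ⟨V₀, hV₀r, hV₀⟩ := hlevi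
  obtain ⟨B, h, g, k, m, lam, hk, hm, hlt, hle, hA⟩ := exists_equiv_rhoTilde (r := r) (s := s)
    (by simp [hrs]) ((1 / 2 : ℝ) • fderiv ℝ (fderiv ℝ ρ) 0)
    (fun v w => by simp [hsymm v w])
    (fun v hv => by
      obtain ⟨w, hw⟩ := hnondeg v hv
      rw [hiter] at hw
      exact ⟨w, by simpa using hw⟩)
    ⟨V₀, hV₀r, fun v hv hv0 => by
      have := hV₀ v hv hv0
      rw [leviForm, hiter, hiter] at this
      simp only [smul_apply, smul_eq_mul]
      linarith⟩
  let shear : (EuclideanSpace ℂ (Fin r) × EuclideanSpace ℂ (Fin s)) ≃ₗ[ℝ]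
      EuclideanSpace ℂ (Fin r) × EuclideanSpace ℂ (Fin s) :=
    LinearEquiv.ofBijective
      ((LinearMap.fst ℝ _ _ + h ∘ₗ LinearMap.snd ℝ _ _).prod (g.toLinearMap ∘ₗ LinearMap.snd ℝ _ _))
      ⟨by
        rw [injective_iff_map_eq_zero]
        rintro ⟨a, b⟩ hab
        obtain ⟨h1, h2⟩ := Prod.mk.inj hab
        have hb : b = 0 := by simpa using h2
        subst hb
        simpa using h1,
      fun p => ⟨(p.1 - h (g.symm p.2), g.symm p.2), by simp⟩⟩
  obtain ⟨hex, hmax⟩ := isGreatest_finrank_negDef_rhoTilde (lam := lam) hk hm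
    (fun j => by
      rcases lt_or_ge (j : ℕ) k with hj | hj
      · exact zero_le_one.trans (hlt j hj).le
      · exact zero_le_one.trans (hle j hj))
    ((B.restrictScalars ℝ) ≪≫ₗ shear)
  have hneg : ∀ v, iteratedFDeriv ℝ 2 ρ 0 ![v, v] < 0 ↔
      rhoTilde k m lam (((B.restrictScalars ℝ) ≪≫ₗ shear) v) < 0 := by
    intro v
    have h1 : (1 / 2 : ℝ) * fderiv ℝ (fderiv ℝ ρ) 0 v v
        = rhoTilde k m lam (((B.restrictScalars ℝ) ≪≫ₗ shear) v) := hA v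
    rw [← h1, hiter]
    constructor <;> intro h <;> linarith
  refine ⟨B, h, g, k, m, lam, hk, hm, hlt, hle, ?_, ?_, ?_⟩
  · simp only [← hA]
    exact hρ2.isLittleO_sub_half_fderiv_fderiv hρ0 hcrit
  · simp only [hneg]
    exact hex
  · intro V hV
    simp only [hneg] at hV
    exact hmax ⟨V, rfl, hV⟩

end
end

section
/- Let λ > 1, let c₀ ∈ (0,1), and let 0 < t₀ < (1 − 1/λ)² c₀. Then there exist a real number t₁ ∈ (t₀, c₀) and a C^∞ convex nondecreasing function h : ℝ → [0,∞) such that: (i) h(t) = 0 for t ≤ t₀; (ii) h(t) = t − t₁ for t ≥ c₀; (iii) t − t₁ ≤ h(t) ≤ t − t₀ for t₀ ≤ t ≤ c₀; and (iv) 0 ≤ h'(t) ≤ 1 and 2t·h''(t) + h'(t) < λ for all t ∈ ℝ. -/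
open Set

open Filter Topology intervalIntegral

/-- The primitive of a smooth function is smooth. -/
lemma contDiff_primitive {f : ℝ → ℝ} (hf : ContDiff ℝ (⊤ : ℕ∞) f) (a : ℝ) :
    ContDiff ℝ (⊤ : ℕ∞) (fun t => ∫ x in a..t, f x) := by
  have hd : deriv (fun t => ∫ x in a..t, f x) = f :=
    funext fun t => hf.continuous.deriv_integral f a t
  refine contDiff_infty_iff_deriv.2 ⟨fun t => ?_, hd.symm ▸ hf⟩
  exact (hf.continuous.integral_hasStrictDerivAt a t).hasDerivAt.differentiableAt

lemma primitive_eq_zero_of_le {f : ℝ → ℝ} {a t : ℝ} (hf : ∀ x ≤ a, f x = 0) (ht : t ≤ a) :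
    ∫ x in a..t, f x = 0 := by
  rw [integral_congr (g := fun _ => (0 : ℝ)), integral_zero]
  intro x hx
  rw [uIcc_of_ge ht] at hx
  exact hf x hx.2

/-- A smooth cutoff equal to one on `[a + δ, b - δ]` and vanishing outside `(a, b)`. -/
lemma exists_smooth_cutoff (a b : ℝ) {δ : ℝ} (hδ : 0 < δ) :
    ∃ ψ : ℝ → ℝ, ContDiff ℝ (⊤ : ℕ∞) ψ ∧ (∀ x, 0 ≤ ψ x) ∧ (∀ x, ψ x ≤ 1) ∧
      (∀ x ≤ a, ψ x = 0) ∧ (∀ x, b ≤ x → ψ x = 0) ∧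
      (∀ x ∈ Icc (a + δ) (b - δ), ψ x = 1) := by
  refine ⟨fun x => Real.smoothTransition ((x - a) / δ) * Real.smoothTransition ((b - x) / δ),
    ?_, fun x => ?_, fun x => ?_, fun x hx => ?_, fun x hx => ?_, fun x hx => ?_⟩
  · exact (Real.smoothTransition.contDiff.comp (by fun_prop)).mul
      (Real.smoothTransition.contDiff.comp (by fun_prop))
  · exact mul_nonneg (Real.smoothTransition.nonneg _) (Real.smoothTransition.nonneg _)
  · exact mul_le_one₀ (Real.smoothTransition.le_one _) (Real.smoothTransition.nonneg _)
      (Real.smoothTransition.le_one _)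
  · simp only
    rw [Real.smoothTransition.zero_of_nonpos (div_nonpos_of_nonpos_of_nonneg (by linarith) hδ.le),
      zero_mul]
  · simp only
    rw [Real.smoothTransition.zero_of_nonpos (x := (b - x) / δ)
      (div_nonpos_of_nonpos_of_nonneg (by linarith) hδ.le), mul_zero]
  · simp only
    rw [Real.smoothTransition.one_of_one_le ((one_le_div hδ).2 (by linarith [hx.1])),
      Real.smoothTransition.one_of_one_le ((one_le_div hδ).2 (by linarith [hx.2])), one_mul]

lemma hasDerivAt_neg_div_sqrt (C : ℝ) {t : ℝ} (ht : 0 < t) :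
    HasDerivAt (fun x => -C / √x) (C / (2 * t * √t)) t := by
  have hs : 0 < √t := Real.sqrt_pos.2 ht
  refine ((hasDerivAt_const t (-C)).div (Real.hasDerivAt_sqrt ht.ne') hs.ne').congr_deriv ?_
  rw [Real.sq_sqrt ht.le]
  field_simp
  ring

lemma integral_div_mul_sqrt (C : ℝ) {a b : ℝ} (ha : 0 < a) (hab : a ≤ b) :
    ∫ x in a..b, C / (2 * x * √x) = C / √a - C / √b := by
  rw [integral_eq_sub_of_hasDerivAt (f := fun x => -C / √x)]
  · ring
  · intro x hx
    rw [uIcc_of_le hab] at hx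
    exact hasDerivAt_neg_div_sqrt C (ha.trans_le hx.1)
  · refine ContinuousOn.intervalIntegrable fun x hx => ContinuousAt.continuousWithinAt ?_
    rw [uIcc_of_le hab] at hx
    have hx0 := ha.trans_le hx.1
    have : 2 * x * √x ≠ 0 := by positivity
    fun_prop (disch := assumption)

/-- A smooth probability density on `[a, b]` whose primitive `g` satisfies `2tg' + g < lam`. -/
lemma exists_density {lam a b : ℝ} (hlam : 1 < lam) (ha : 0 < a)
    (hab : a < (1 - 1 / lam) ^ 2 * b) (hb : 0 < b) :
    ∃ k : ℝ → ℝ, ContDiff ℝ (⊤ : ℕ∞) k ∧ (∀ x, 0 ≤ k x) ∧ (∀ x ≤ a, k x = 0) ∧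
      (∀ x, b ≤ x → k x = 0) ∧ ∫ x in a..b, k x = 1 ∧
      ∀ t, 2 * t * k t + ∫ x in a..t, k x < lam := by
  have hlam0 : 0 < lam := by linarith
  have hq : 0 < 1 - 1 / lam := by
    rw [sub_pos, div_lt_one hlam0]; exact hlam
  have hq1 : 1 - 1 / lam < 1 := by
    have : 0 < 1 / lam := by positivity
    linarith
  have hab' : a < b := by nlinarith [mul_pos hq hb]
  have hsa : 0 < √a := Real.sqrt_pos.2 ha
  have hsb : 0 < √b := Real.sqrt_pos.2 hb
  have hsqrt : √a < (1 - 1 / lam) * √b := by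
    rw [Real.sqrt_lt' (by positivity), mul_pow, Real.sq_sqrt hb.le]
    exact hab
  set C := lam * √a with hC
  have hCpos : 0 < C := by positivity
  have hCa : C / √a = lam := by rw [hC]; field_simp
  have hgap : 1 < C / √a - C / √b := by
    have h1 : C / √b < lam - 1 := by
      rw [div_lt_iff₀ hsb, hC]
      calc lam * √a < lam * ((1 - 1 / lam) * √b) := by gcongr
        _ = (lam - 1) * √b := by field_simp
    linarith
  obtain ⟨δ, hδ, hδab, hδgap⟩ : ∃ δ > 0, δ < (b - a) / 2 ∧
      1 < C / √(a + δ) - C / √(b - δ) := by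
    have hcont : ContinuousAt (fun δ => C / √(a + δ) - C / √(b - δ)) 0 := by
      have h1 : √(a + 0) ≠ 0 := by simpa using hsa.ne'
      have h2 : √(b - 0) ≠ 0 := by simpa using hsb.ne'
      fun_prop (disch := assumption)
    have h1 : ∀ᶠ δ in 𝓝[>] (0 : ℝ), 1 < C / √(a + δ) - C / √(b - δ) :=
      (hcont.eventually (lt_mem_nhds (by simpa using hgap))).filter_mono nhdsWithin_le_nhds
    have h2 : ∀ᶠ δ in 𝓝[>] (0 : ℝ), δ < (b - a) / 2 :=
      (gt_mem_nhds (by linarith)).filter_mono nhdsWithin_le_nhds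
    obtain ⟨δ, hδ, hδ1, hδ2⟩ := (eventually_mem_nhdsWithin.and (h1.and h2)).exists
    exact ⟨δ, hδ, hδ2, hδ1⟩
  obtain ⟨ψ, hψ, hψ0, hψ1, hψa, hψb, hψm⟩ := exists_smooth_cutoff a b hδ
  set m : ℝ → ℝ := fun x => ψ x * (C / (2 * x * √x)) with hm
  have hma : ∀ x ≤ a, m x = 0 := fun x hx => by simp [hm, hψa x hx]
  have hmb : ∀ x, b ≤ x → m x = 0 := fun x hx => by simp [hm, hψb x hx]
  have hm0 : ∀ x, 0 ≤ m x := fun x => by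
    rcases le_or_gt x a with hx | hx
    · exact (hma x hx).ge
    · have := ha.trans hx
      exact mul_nonneg (hψ0 x) (by positivity)
  have hms : ContDiff ℝ (⊤ : ℕ∞) m := contDiff_iff_contDiffAt.2 fun x => by
    rcases lt_or_ge x a with hx | hx
    · refine contDiffAt_const (c := (0 : ℝ)) |>.congr_of_eventuallyEq ?_
      filter_upwards [gt_mem_nhds hx] with y hy using hma y hy.le
    · have hx0 := ha.trans_le hx
      exact hψ.contDiffAt.mul (contDiffAt_const.div
        ((contDiffAt_const.mul contDiffAt_id).mul (Real.contDiffAt_sqrt hx0.ne'))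
        (by positivity))
  have hmi : ∀ u v, IntervalIntegrable m MeasureTheory.volume u v :=
    fun u v => hms.continuous.intervalIntegrable u v
  set I := ∫ x in a..b, m x with hI
  have hI1 : 1 < I := by
    have h1 : ∫ x in (a + δ)..(b - δ), m x = C / √(a + δ) - C / √(b - δ) := by
      rw [← integral_div_mul_sqrt C (by linarith) (by linarith)]
      refine integral_congr fun x hx => ?_
      rw [uIcc_of_le (by linarith)] at hx
      simp [hm, hψm x hx]
    have h2 : ∫ x in (a + δ)..(b - δ), m x ≤ I :=
      integral_mono_interval (by linarith) (by linarith) (by linarith)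
        (Eventually.of_forall hm0) (hmi a b)
    linarith
  have hI0 : 0 < I := by linarith
  have hbound : ∀ t, a ≤ t → 2 * t * m t + ∫ x in a..t, m x ≤ lam := fun t ht => by
    have ht0 := ha.trans_le ht
    have hst : 0 < √t := Real.sqrt_pos.2 ht0
    have h1 : ∫ x in a..t, m x ≤ C / √a - C / √t := by
      rw [← integral_div_mul_sqrt C ha ht]
      refine integral_mono_on ht (hmi a t) ?_ fun x hx => ?_
      · refine ContinuousOn.intervalIntegrable fun x hx => ContinuousAt.continuousWithinAt ?_
        rw [uIcc_of_le ht] at hx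
        have hx0 := ha.trans_le hx.1
        have : 2 * x * √x ≠ 0 := by positivity
        fun_prop (disch := assumption)
      · have hx0 := ha.trans_le hx.1
        exact mul_le_of_le_one_left (by positivity) (hψ1 x)
    have h2 : 2 * t * m t ≤ C / √t := by
      have : 2 * t * m t = ψ t * (C / √t) := by
        simp only [hm]; field_simp
      rw [this]
      exact mul_le_of_le_one_left (by positivity) (hψ1 t)
    linarith
  refine ⟨fun x => m x / I, hms.div_const I, fun x => div_nonneg (hm0 x) hI0.le,
    fun x hx => by simp [hma x hx], fun x hx => by simp [hmb x hx], ?_, fun t => ?_⟩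
  · rw [integral_div, ← hI, div_self hI0.ne']
  · rw [integral_div]
    rcases le_or_gt t a with ht | ht
    · have : ∫ x in a..t, m x = 0 := primitive_eq_zero_of_le hma ht
      simpa [this, hma t ht] using hlam0
    · have h := hbound t ht.le
      calc 2 * t * (m t / I) + (∫ x in a..t, m x) / I
          = (2 * t * m t + ∫ x in a..t, m x) / I := by ring
        _ ≤ lam / I := by gcongr
        _ < lam := div_lt_self hlam0 hI1

/-- The auxiliary convex function `h` used in the proof of Lemma 3.2
(crossing a critical level of a `q`-convex function). -/
theorem exists_crossing_function
    {lam c₀ t₀ : ℝ} (hlam : 1 < lam) (hc₀ : c₀ ∈ Set.Ioo (0 : ℝ) 1)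
    (ht₀pos : 0 < t₀) (ht₀ : t₀ < (1 - 1 / lam) ^ 2 * c₀) :
    ∃ (t₁ : ℝ) (h : ℝ → ℝ),
      t₀ < t₁ ∧ t₁ < c₀ ∧
      ContDiff ℝ (⊤ : ℕ∞) h ∧ ConvexOn ℝ Set.univ h ∧ Monotone h ∧ (∀ t, 0 ≤ h t) ∧
      (∀ t, t ≤ t₀ → h t = 0) ∧
      (∀ t, c₀ ≤ t → h t = t - t₁) ∧
      (∀ t, t₀ ≤ t → t ≤ c₀ → t - t₁ ≤ h t ∧ h t ≤ t - t₀) ∧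
      (∀ t, 0 ≤ deriv h t ∧ deriv h t ≤ 1 ∧
        2 * t * deriv (deriv h) t + deriv h t < lam) := by
  obtain ⟨k, hk, hk0, hka, hkb, hk1, hklam⟩ := exists_density hlam ht₀pos ht₀ hc₀.1
  have hlt : t₀ < c₀ := by
    by_contra! hle
    have : ∫ x in t₀..c₀, k x = 0 := primitive_eq_zero_of_le hka hle
    linarith
  set g : ℝ → ℝ := fun t => ∫ x in t₀..t, k x with hg
  have hgs : ContDiff ℝ (⊤ : ℕ∞) g := contDiff_primitive hk t₀
  have hgd : deriv g = k := funext fun t => hk.continuous.deriv_integral k t₀ t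
  have hgmono : Monotone g :=
    monotone_of_deriv_nonneg (hgs.differentiable (by simp)) (by simpa [hgd] using hk0)
  have hga : ∀ t ≤ t₀, g t = 0 := fun t ht => primitive_eq_zero_of_le hka ht
  have hgb : ∀ t, c₀ ≤ t → g t = 1 := fun t ht => by
    simp only [hg]
    rw [← integral_add_adjacent_intervals (hk.continuous.intervalIntegrable t₀ c₀)
      (hk.continuous.intervalIntegrable c₀ t), hk1,
      integral_congr (a := c₀) (g := fun _ => (0 : ℝ)), integral_zero, add_zero]
    intro x hx
    rw [uIcc_of_le ht] at hx
    exact hkb x hx.1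
  have hg0 : ∀ t, 0 ≤ g t := fun t => by
    rw [← hga (min t t₀) (min_le_right _ _)]; exact hgmono (min_le_left _ _)
  have hg1 : ∀ t, g t ≤ 1 := fun t => by
    rw [← hgb (max t c₀) (le_max_right _ _)]; exact hgmono (le_max_left _ _)
  have hgi : ∀ u v, IntervalIntegrable g MeasureTheory.volume u v :=
    fun u v => hgs.continuous.intervalIntegrable u v
  have hgle : ∀ u v, u ≤ v → ∫ x in u..v, g x ≤ v - u := fun u v huv => by
    simpa using integral_mono_on huv (hgi u v) intervalIntegrable_const fun x _ => hg1 x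
  set h : ℝ → ℝ := fun t => ∫ x in t₀..t, g x
  have hhs : ContDiff ℝ (⊤ : ℕ∞) h := contDiff_primitive hgs t₀
  have hhd : deriv h = g := funext fun t => hgs.continuous.deriv_integral g t₀ t
  have hdiff : Differentiable ℝ h := hhs.differentiable (by simp)
  have hhmono : Monotone h := monotone_of_deriv_nonneg hdiff (by simpa [hhd] using hg0)
  have hha : ∀ t ≤ t₀, h t = 0 := fun t ht => primitive_eq_zero_of_le hga ht
  have hadd : ∀ t, h t + ∫ x in t..c₀, g x = h c₀ := fun t =>
    integral_add_adjacent_intervals (hgi t₀ t) (hgi t c₀)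
  have hpos : 0 < h c₀ := by
    have := integral_lt_integral_of_continuousOn_of_le_of_exists_lt hlt
      (f := fun _ => (0 : ℝ)) continuousOn_const hgs.continuous.continuousOn
      (fun x _ => hg0 x) ⟨c₀, right_mem_Icc.2 hlt.le, by simp [hgb c₀ le_rfl]⟩
    simpa using this
  have hltc : h c₀ < c₀ - t₀ := by
    have := integral_lt_integral_of_continuousOn_of_le_of_exists_lt hlt
      (g := fun _ => (1 : ℝ)) hgs.continuous.continuousOn continuousOn_const
      (fun x _ => hg1 x) ⟨t₀, left_mem_Icc.2 hlt.le, by simp [hga t₀ le_rfl]⟩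
    simpa using this
  refine ⟨c₀ - h c₀, h, by linarith, by linarith, hhs, ?_, hhmono, fun t => ?_, hha,
    fun t ht => ?_, fun t ht htc => ⟨?_, hgle t₀ t ht⟩, fun t => ?_⟩
  · exact Monotone.convexOn_univ_of_deriv hdiff (hhd.symm ▸ hgmono)
  · rw [← hha (min t t₀) (min_le_right _ _)]; exact hhmono (min_le_left _ _)
  · have h1 : ∫ x in c₀..t, g x = t - c₀ := by
      rw [integral_congr (g := fun _ => (1 : ℝ))]
      · simp
      · intro x hx
        rw [uIcc_of_le ht] at hx
        exact hgb x hx.1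
    have h2 := hadd t
    rw [integral_symm, h1] at h2
    linarith
  · linarith [hadd t, hgle t c₀ htc]
  · rw [hhd, hgd]
    exact ⟨hg0 t, hg1 t, hklam t⟩
end

section
/- Let λ > 1, let 1 ≤ k ≤ r be integers, let c ≥ 0, and let λ₁,…,λ_r be real numbers with λ_j ≥ λ for 1 ≤ j ≤ k and λ_j ≥ 1 for k < j ≤ r. Let h : ℝ → ℝ be a C² convex function such that 0 ≤ h'(t) ≤ 1 and 2t·h''(t) + h'(t) < λ for all t ∈ ℝ. Then the function τ : ℂ^r → ℝ defined by τ(x + iy) = −h(Σ_{j=1}^k x_j² + c) + Σ_{j=1}^r λ_j y_j² + Σ_{j=k+1}^r x_j² (where x, y ∈ ℝ^r) is strongly plurisubharmonic at every point of ℂ^r, i.e., its Levi form is positive definite at every point. -/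
open Set Metric Complex Bornology

noncomputable section

/-- The second derivative of a `C²` function along a line is its Hessian on the diagonal. -/
lemma iteratedFDeriv_two_diag_eq {E : Type*} [NormedAddCommGroup E] [NormedSpace ℝ E]
    {f : E → ℝ} (hf : ContDiff ℝ 2 f) {x v : E} {g g' : ℝ → ℝ} {d : ℝ}
    (hfg : ∀ s : ℝ, f (x + s • v) = g s) (hg : ∀ s, HasDerivAt g (g' s) s)
    (hg' : HasDerivAt g' d 0) :
    iteratedFDeriv ℝ 2 f x ![v, v] = d := by
  have hline : ∀ s : ℝ, HasDerivAt (fun s : ℝ => x + s • v) v s := fun s => by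
    simpa using ((hasDerivAt_id s).smul_const v).const_add x
  have hfst : ∀ s : ℝ, fderiv ℝ f (x + s • v) v = g' s := fun s => by
    have hcomp : HasDerivAt (fun s : ℝ => f (x + s • v)) (fderiv ℝ f (x + s • v) v) s :=
      ((hf.differentiable (by norm_num)) _).hasFDerivAt.comp_hasDerivAt s (hline s)
    rw [funext hfg] at hcomp
    exact hcomp.unique (hg s)
  have hf' : ContDiff ℝ 1 (fderiv ℝ f) := hf.fderiv_right (by norm_num)
  have hsnd : HasDerivAt (fun s : ℝ => fderiv ℝ f (x + s • v))
      (fderiv ℝ (fderiv ℝ f) x v) 0 := by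
    have hx : HasFDerivAt (fderiv ℝ f) (fderiv ℝ (fderiv ℝ f) x) (x + (0 : ℝ) • v) := by
      simpa using ((hf'.differentiable (by norm_num)) x).hasFDerivAt
    exact hx.comp_hasDerivAt 0 (hline 0)
  have hsnd' : HasDerivAt (fun s : ℝ => fderiv ℝ f (x + s • v) v)
      (fderiv ℝ (fderiv ℝ f) x v v) 0 := by
    simpa using hsnd.clm_apply (hasDerivAt_const (0 : ℝ) v)
  rw [funext hfst] at hsnd'
  rw [iteratedFDeriv_two_apply]
  exact hsnd'.unique hg'

/-- The Hessian of `-h ∘ p + q` in the direction `v`, where `p` and `q` restrict to quadratic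
polynomials on the line through `x` in the direction `v`. -/
lemma iteratedFDeriv_two_neg_comp_add {E : Type*} [NormedAddCommGroup E] [NormedSpace ℝ E]
    {h : ℝ → ℝ} (hh : ContDiff ℝ 2 h) {p q : E → ℝ} (hp : ContDiff ℝ 2 p)
    (hq : ContDiff ℝ 2 q) {x v : E} {p₁ p₂ q₁ q₂ : ℝ}
    (hpv : ∀ s : ℝ, p (x + s • v) = p x + p₁ * s + p₂ * s ^ 2)
    (hqv : ∀ s : ℝ, q (x + s • v) = q x + q₁ * s + q₂ * s ^ 2) :
    iteratedFDeriv ℝ 2 (fun y => -h (p y) + q y) x ![v, v] =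
      -(deriv (deriv h) (p x) * p₁ ^ 2 + 2 * deriv h (p x) * p₂) + 2 * q₂ := by
  have hquad : ∀ a b c s : ℝ,
      HasDerivAt (fun s : ℝ => a + b * s + c * s ^ 2) (b + 2 * c * s) s := fun a b c s => by
    have := (((hasDerivAt_id s).const_mul b).const_add a).add
      ((hasDerivAt_pow 2 s).const_mul c)
    refine this.congr_deriv ?_
    norm_num
    ring
  have hlin : ∀ a b s : ℝ, HasDerivAt (fun s : ℝ => a + b * s) b s := fun a b s => by
    simpa using ((hasDerivAt_id s).const_mul b).const_add a
  have hh' : ContDiff ℝ 1 (deriv h) := ((contDiff_succ_iff_deriv (n := 1)).1 hh).2.2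
  have hd : ∀ t, HasDerivAt h (deriv h t) t := fun t =>
    ((hh.differentiable (by norm_num)) t).hasDerivAt
  have hdd : ∀ t, HasDerivAt (deriv h) (deriv (deriv h) t) t := fun t =>
    ((hh'.differentiable (by norm_num)) t).hasDerivAt
  refine iteratedFDeriv_two_diag_eq ((hh.comp hp).neg.add hq)
    (g := fun s => -h (p x + p₁ * s + p₂ * s ^ 2) + (q x + q₁ * s + q₂ * s ^ 2))
    (g' := fun s => -(deriv h (p x + p₁ * s + p₂ * s ^ 2) * (p₁ + 2 * p₂ * s)) +
      (q₁ + 2 * q₂ * s)) (fun s => ?_) (fun s => ?_) ?_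
  · simp only [Function.comp_apply, hpv, hqv]
  · exact ((hd _).comp s (hquad _ _ _ s)).neg.add (hquad _ _ _ s)
  · have := ((((hdd _).comp 0 (hquad (p x) p₁ p₂ 0)).mul (hlin p₁ (2 * p₂) 0)).neg).add
      (hlin q₁ (2 * q₂) 0)
    refine this.congr_deriv ?_
    simp only [Function.comp_apply, mul_zero, add_zero, ne_eq, OfNat.ofNat_ne_zero,
      not_false_eq_true, zero_pow]
    ring

/-- The Hessian of the crossing function in the direction `v`. -/
lemma iteratedFDeriv_two_crossing {r : ℕ} (k : ℕ) (c : ℝ) (lamj : Fin r → ℝ)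
    {h : ℝ → ℝ} (hh : ContDiff ℝ 2 h) (z v : EuclideanSpace ℂ (Fin r)) :
    iteratedFDeriv ℝ 2 (fun ζ : EuclideanSpace ℂ (Fin r) =>
        -h ((∑ j : Fin r, if (j : ℕ) < k then (ζ j).re ^ 2 else 0) + c)
        + (∑ j : Fin r, lamj j * (ζ j).im ^ 2)
        + (∑ j : Fin r, if (j : ℕ) < k then 0 else (ζ j).re ^ 2)) z ![v, v] =
      -(deriv (deriv h) ((∑ j : Fin r, if (j : ℕ) < k then (z j).re ^ 2 else 0) + c) *
          (2 * ∑ j : Fin r, if (j : ℕ) < k then (z j).re * (v j).re else 0) ^ 2 +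
        2 * deriv h ((∑ j : Fin r, if (j : ℕ) < k then (z j).re ^ 2 else 0) + c) *
          ∑ j : Fin r, if (j : ℕ) < k then (v j).re ^ 2 else 0) +
      2 * ∑ j : Fin r, (lamj j * (v j).im ^ 2 + if (j : ℕ) < k then 0 else (v j).re ^ 2) := by
  have hre : ∀ j : Fin r,
      ContDiff ℝ 2 (fun ζ : EuclideanSpace ℂ (Fin r) => (ζ j).re) := fun j =>
    (Complex.reCLM.comp ((EuclideanSpace.proj (𝕜 := ℂ) j).restrictScalars ℝ)).contDiff
  have him : ∀ j : Fin r,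
      ContDiff ℝ 2 (fun ζ : EuclideanSpace ℂ (Fin r) => (ζ j).im) := fun j =>
    (Complex.imCLM.comp ((EuclideanSpace.proj (𝕜 := ℂ) j).restrictScalars ℝ)).contDiff
  have hp : ContDiff ℝ 2 (fun ζ : EuclideanSpace ℂ (Fin r) =>
      (∑ j : Fin r, if (j : ℕ) < k then (ζ j).re ^ 2 else 0) + c) := by
    refine (ContDiff.sum fun j _ => ?_).add contDiff_const
    split_ifs
    · exact (hre j).pow 2
    · exact contDiff_const
  have hq : ContDiff ℝ 2 (fun ζ : EuclideanSpace ℂ (Fin r) =>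
      ∑ j : Fin r, (lamj j * (ζ j).im ^ 2 + if (j : ℕ) < k then 0 else (ζ j).re ^ 2)) := by
    refine ContDiff.sum fun j _ => (contDiff_const.mul ((him j).pow 2)).add ?_
    split_ifs
    · exact contDiff_const
    · exact (hre j).pow 2
  simp only [add_assoc (-h _), ← Finset.sum_add_distrib]
  refine iteratedFDeriv_two_neg_comp_add hh hp hq
    (q₁ := 2 * ∑ j : Fin r, (lamj j * ((z j).im * (v j).im) +
      if (j : ℕ) < k then 0 else (z j).re * (v j).re)) (fun s => ?_) (fun s => ?_)
  · rw [add_right_comm _ c, add_right_comm _ c]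
    congr 1
    simp only [Finset.mul_sum, Finset.sum_mul, ← Finset.sum_add_distrib]
    refine Finset.sum_congr rfl fun j _ => ?_
    split_ifs <;> simp
    ring
  · simp only [Finset.mul_sum, Finset.sum_mul, ← Finset.sum_add_distrib]
    refine Finset.sum_congr rfl fun j _ => ?_
    split_ifs <;> simp <;> ring

/-- Cauchy–Schwarz over the indices satisfying `P`. -/
lemma sq_sum_ite_mul_le {ι : Type*} [Fintype ι] (P : ι → Prop) [DecidablePred P] (a b : ι → ℝ) :
    (∑ j, if P j then a j * b j else 0) ^ 2 ≤
      (∑ j, if P j then a j ^ 2 else 0) * ∑ j, if P j then b j ^ 2 else 0 := by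
  simp only [← Finset.sum_filter]
  exact Finset.sum_mul_sq_le_sq_mul_sq _ _ _

/-- The computational core of Lemma 3.2: the function
`τ(x+iy) = -h(Σ_{j≤k} x_j² + c) + Σ_j λ_j y_j² + Σ_{j>k} x_j²`
is strongly plurisubharmonic on all of `ℂ^r`. -/
theorem crossing_function_strongly_psh
    {lam c : ℝ} (hlam : 1 < lam) (hc : 0 ≤ c)
    {r k : ℕ} (hk1 : 1 ≤ k) (hkr : k ≤ r)
    {lamj : Fin r → ℝ}
    (hl1 : ∀ j : Fin r, (j : ℕ) < k → lam ≤ lamj j)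
    (hl2 : ∀ j : Fin r, k ≤ (j : ℕ) → 1 ≤ lamj j)
    {h : ℝ → ℝ} (hh : ContDiff ℝ 2 h) (hconv : ConvexOn ℝ Set.univ h)
    (hd1 : ∀ t, 0 ≤ deriv h t) (hd2 : ∀ t, deriv h t ≤ 1)
    (hd3 : ∀ t, 2 * t * deriv (deriv h) t + deriv h t < lam) :
    ∀ z v : EuclideanSpace ℂ (Fin r), v ≠ 0 →
      0 < leviForm (fun ζ =>
        -h ((∑ j : Fin r, if (j : ℕ) < k then (ζ j).re ^ 2 else 0) + c)
        + (∑ j : Fin r, lamj j * (ζ j).im ^ 2)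
        + (∑ j : Fin r, if (j : ℕ) < k then 0 else (ζ j).re ^ 2)) z v := by
  intro z v hv
  rw [leviForm, iteratedFDeriv_two_crossing k c lamj hh, iteratedFDeriv_two_crossing k c lamj hh]
  have hcs_re := sq_sum_ite_mul_le (fun j : Fin r => (j : ℕ) < k)
    (fun j => (z j).re) (fun j => (v j).re)
  have hcs_im := sq_sum_ite_mul_le (fun j : Fin r => (j : ℕ) < k)
    (fun j => (z j).re) (fun j => ((Complex.I • v) j).re)
  set S := ∑ j : Fin r, if (j : ℕ) < k then (z j).re ^ 2 else 0
  have hmono : Monotone (deriv h) := by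
    have := hconv.monotoneOn_deriv (fun x _ => (hh.differentiable (by norm_num)) x)
    exact monotoneOn_univ.1 this
  have hdd : 0 ≤ deriv (deriv h) (S + c) := hmono.deriv_nonneg
  have hlt := hd3 (S + c)
  set α := deriv (deriv h) (S + c)
  set β := deriv h (S + c)
  have hcoef : 2 * S * α + β < lam := by nlinarith [mul_nonneg hc hdd]
  have hpos : 0 < ∑ j : Fin r, (lamj j + if (j : ℕ) < k then -(2 * S * α + β) else 1) *
      ((v j).re ^ 2 + (v j).im ^ 2) := by
    have hweight : ∀ j : Fin r,
        0 < lamj j + if (j : ℕ) < k then -(2 * S * α + β) else 1 := fun j => by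
      split_ifs with hj
      · linarith [hl1 j hj]
      · linarith [hl2 j (not_lt.1 hj)]
    obtain ⟨i, hi⟩ : ∃ i, v i ≠ 0 := by
      by_contra! hzero
      exact hv (PiLp.ext hzero)
    refine Finset.sum_pos' (fun j _ => mul_nonneg (hweight j).le (by positivity))
      ⟨i, Finset.mem_univ i, mul_pos (hweight i) ?_⟩
    simpa [Complex.normSq_apply, sq] using Complex.normSq_pos.2 hi
  have hsum : ∑ j : Fin r, (lamj j + if (j : ℕ) < k then -(2 * S * α + β) else 1) *
      ((v j).re ^ 2 + (v j).im ^ 2) =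
      -((2 * S * α + β) * ((∑ j : Fin r, if (j : ℕ) < k then (v j).re ^ 2 else 0) +
        ∑ j : Fin r, if (j : ℕ) < k then ((Complex.I • v) j).re ^ 2 else 0)) +
      ((∑ j : Fin r, (lamj j * (v j).im ^ 2 + if (j : ℕ) < k then 0 else (v j).re ^ 2)) +
        ∑ j : Fin r, (lamj j * ((Complex.I • v) j).im ^ 2 +
          if (j : ℕ) < k then 0 else ((Complex.I • v) j).re ^ 2)) := by
    simp only [← Finset.sum_add_distrib, Finset.mul_sum, ← Finset.sum_neg_distrib]
    refine Finset.sum_congr rfl fun j _ => ?_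
    split_ifs <;> simp <;> ring
  rw [hsum] at hpos
  nlinarith [mul_le_mul_of_nonneg_left hcs_re hdd, mul_le_mul_of_nonneg_left hcs_im hdd]

end
end
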